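/- Let x ∈ (0, 2) be real and k ≥ 1 a natural number. Then there exist ε₁, ε₂, …, ε_k ∈ {-1, 1} with x = √(2 + ε₁√(2 + ⋯ + ε_k√2)) if and only if x = 2·cos(β·π/2^{k+2}) for some odd integer β with 1 ≤ β ≤ 2^{k+1} − 1. -/

import Mathlib

open Filter Real

/-- The nested radical `r_n(c) = √(2 + ε₁√(2 + ε₂√(2 + ⋯ + ε_n√(2 + c))))`,
defined by the recursion `r₀(c) = √(2 + c)`, `r_n(c) = r_{n-1}(ε_n √(2 + c))`;
so `nest ε k 0 = √(2 + ε₁√(2 + ⋯ + ε_k√2))`. -/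
noncomputable def nest (ε : ℕ → ℝ) : ℕ → ℝ → ℝ
  | 0, c => Real.sqrt (2 + c)
  | n + 1, c => nest ε n (ε (n + 1) * Real.sqrt (2 + c))

/-- Peeling off the outermost radical of `nest` shifts the signs by one. -/
lemma nest_succ_eq_sqrt {ε δ : ℕ → ℝ} (h : ∀ i, 1 ≤ i → ε (i + 1) = δ i) (n : ℕ) (c : ℝ) :
    nest ε (n + 1) c = √(2 + ε 1 * nest δ n c) := by
  induction n generalizing c with
  | zero => simp [nest]
  | succ n ih =>
    rw [nest, ih, h (n + 1) (Nat.le_add_left 1 n)]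
    rfl

lemma sqrt_two_add_two_mul_cos {θ : ℝ} (h₁ : -π ≤ θ) (h₂ : θ ≤ π) :
    √(2 + 2 * cos θ) = 2 * cos (θ / 2) := by
  have hcos : 0 ≤ cos (θ / 2) := cos_nonneg_of_mem_Icc ⟨by linarith, by linarith⟩
  rw [← sqrt_sq (mul_nonneg zero_le_two hcos), mul_pow, cos_sq, mul_div_cancel₀ θ two_ne_zero]
  ring_nf

lemma sqrt_two_add_two_mul_cos_dyadic (n : ℕ) {β : ℤ} (h₁ : 0 ≤ β) (h₂ : β ≤ 2 ^ n) :
    √(2 + 2 * cos (β * π / 2 ^ n)) = 2 * cos (β * π / 2 ^ (n + 1)) := by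
  have h₁' : (0 : ℝ) ≤ β := by exact_mod_cast h₁
  have h₂' : (β : ℝ) ≤ 2 ^ n := by exact_mod_cast h₂
  have hpos : 0 ≤ β * π / 2 ^ n := by positivity
  have hle : β * π / 2 ^ n ≤ π := by
    rw [div_le_iff₀ (by positivity), mul_comm π]
    gcongr
  rw [sqrt_two_add_two_mul_cos (by linarith [pi_pos]) hle, pow_succ, div_div]

lemma cos_dyadic_reflect (n : ℕ) (β : ℤ) :
    cos (((2 ^ n - β : ℤ) : ℝ) * π / 2 ^ n) = -cos (β * π / 2 ^ n) := by
  rw [← cos_pi_sub]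
  congr 1
  push_cast
  field_simp

/-- The characterisation of the values of `nest`, for any number of signs and any real `x`. -/
lemma exists_eq_nest_iff (k : ℕ) (x : ℝ) :
    (∃ ε : ℕ → ℝ, (∀ i, 1 ≤ i → i ≤ k → ε i = 1 ∨ ε i = -1) ∧ x = nest ε k 0) ↔
    (∃ β : ℤ, Odd β ∧ 1 ≤ β ∧ β ≤ 2 ^ (k + 1) - 1 ∧
      x = 2 * cos (β * π / 2 ^ (k + 2))) := by
  induction k generalizing x with
  | zero =>
    have hval : 2 * cos (((1 : ℤ) : ℝ) * π / 2 ^ (0 + 2)) = √2 := by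
      rw [show ((1 : ℤ) : ℝ) * π / 2 ^ (0 + 2) = π / 4 by norm_num, cos_pi_div_four]
      ring
    constructor
    · rintro ⟨ε, -, rfl⟩
      exact ⟨1, odd_one, le_rfl, by norm_num, by rw [hval]; simp [nest]⟩
    · rintro ⟨β, -, h₁, h₂, rfl⟩
      obtain rfl : β = 1 := by norm_num at h₂; omega
      exact ⟨fun _ => 1, by simp, by rw [hval]; simp [nest]⟩
  | succ n ih =>
    have hpow : (2 : ℤ) ^ (n + 2) = 2 * 2 ^ (n + 1) := pow_succ' 2 (n + 1)
    have hone : (1 : ℤ) ≤ 2 ^ (n + 1) := one_le_pow₀ one_le_two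
    constructor
    · rintro ⟨ε, hε, rfl⟩
      obtain ⟨β, hodd, h₁, h₂, hβ⟩ := (ih (nest (fun i => ε (i + 1)) n 0)).1
        ⟨_, fun i _ hi' => hε (i + 1) (by omega) (by omega), rfl⟩
      rw [nest_succ_eq_sqrt (fun i _ => rfl), hβ]
      rcases hε 1 le_rfl (by omega) with h | h <;> rw [h]
      · refine ⟨β, hodd, h₁, by omega, ?_⟩
        rw [one_mul, sqrt_two_add_two_mul_cos_dyadic _ (by omega) (by omega)]
      · refine ⟨2 ^ (n + 2) - β, ?_, by omega, by omega, ?_⟩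
        · exact (even_two.pow_of_ne_zero (by omega)).sub_odd hodd
        · rw [← sqrt_two_add_two_mul_cos_dyadic (n + 2) (by omega) (by omega), cos_dyadic_reflect]
          ring_nf
    · rintro ⟨β, hodd, h₁, h₂, rfl⟩
      obtain ⟨s, γ, hs, hodd', hγ₁, hγ₂, hcos⟩ : ∃ (s : ℝ) (γ : ℤ), (s = 1 ∨ s = -1) ∧ Odd γ ∧
          1 ≤ γ ∧ γ ≤ 2 ^ (n + 1) - 1 ∧
          cos (β * π / 2 ^ (n + 2)) = s * cos (γ * π / 2 ^ (n + 2)) := by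
        by_cases hβ : β ≤ 2 ^ (n + 1) - 1
        · exact ⟨1, β, .inl rfl, hodd, h₁, hβ, (one_mul _).symm⟩
        · have hne : β ≠ 2 ^ (n + 1) := by
            rintro rfl
            exact Int.not_even_iff_odd.2 hodd (even_two.pow_of_ne_zero (by omega))
          refine ⟨-1, 2 ^ (n + 2) - β, .inr rfl, ?_, by omega, by omega, ?_⟩
          · exact (even_two.pow_of_ne_zero (by omega)).sub_odd hodd
          · rw [cos_dyadic_reflect]
            ring
      obtain ⟨δ, hδ, hx⟩ := (ih _).2 ⟨γ, hodd', hγ₁, hγ₂, rfl⟩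
      refine ⟨fun i => if i = 1 then s else δ (i - 1), fun i hi hi' => ?_, ?_⟩
      · by_cases h : i = 1
        · simpa [h] using hs
        · simpa [h] using hδ (i - 1) (by omega) (by omega)
      · rw [nest_succ_eq_sqrt (δ := δ) (fun i hi => by simp [show i ≠ 0 by omega]), ← hx,
          ← sqrt_two_add_two_mul_cos_dyadic _ (by omega) (by omega), hcos, if_pos rfl,
          mul_left_comm]

/-- Theorem 3: for `x ∈ (0, 2)` and `k ≥ 1`, there exist signs
`ε₁, …, ε_k ∈ {-1, 1}` with `x = √(2 + ε₁√(2 + ⋯ + ε_k√2))` iff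
`x = 2 cos(βπ/2^{k+2})` for some odd integer `β` with `1 ≤ β ≤ 2^{k+1} - 1`. -/
theorem finite_nested_radical_iff (x : ℝ) (hx : x ∈ Set.Ioo (0 : ℝ) 2)
    (k : ℕ) (hk : 1 ≤ k) :
    (∃ ε : ℕ → ℝ, (∀ i, 1 ≤ i → i ≤ k → ε i = 1 ∨ ε i = -1) ∧ x = nest ε k 0) ↔
    (∃ β : ℤ, Odd β ∧ 1 ≤ β ∧ β ≤ 2 ^ (k + 1) - 1 ∧
      x = 2 * Real.cos (β * π / 2 ^ (k + 2))) :=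
  exists_eq_nest_iff k x
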